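/- Let D be a v-reduced divisor on a metric graph Γ. Then D is linearly equivalent to an effective divisor if and only if D is itself effective. -/

import Mathlib

open scoped ENNReal
open Set Function

namespace TropGraph

variable {G : Type*} [MetricSpace G]

/-! ### Metric graphs: length spaces with star-shaped neighbourhoods -/

/-- The length of a path, via the extended variation of its extension to `ℝ`. -/
noncomputable def pathLength {x y : G} (g : Path x y) : ℝ≥0∞ :=
  eVariationOn (fun t : ℝ => g.extend t) (Set.Icc 0 1)

/-- The star with `v` branches of radius `ε`: a disjoint union of `v` copies of `[0, ε)`
with all the zeroes identified. -/
def starSetoid (v : ℕ) (ε : ℝ) : Setoid (Fin v × Set.Ico (0:ℝ) ε) where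
  r a b := a = b ∨ ((a.2 : ℝ) = 0 ∧ (b.2 : ℝ) = 0)
  iseqv :=
    { refl := fun _ => Or.inl rfl
      symm := fun h => h.imp Eq.symm And.symm
      trans := fun h₁ h₂ => by
        rcases h₁ with rfl | h₁
        · exact h₂
        · rcases h₂ with rfl | h₂
          · exact Or.inr h₁
          · exact Or.inr ⟨h₁.1, h₂.2⟩ }

/-- The glued star-shaped space `⊔_{i=1}^v [0, ε) / ∼`. -/
def StarGlue (v : ℕ) (ε : ℝ) : Type :=
  Quotient (starSetoid v ε)

instance (v : ℕ) (ε : ℝ) : TopologicalSpace (StarGlue v ε) := by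
  unfold StarGlue; infer_instance

/-- `U` is a star-shaped neighbourhood of `x` of valence `v`. -/
def IsStarNbhdOf (x : G) (v : ℕ) (U : Set G) : Prop :=
  ∃ (ε : ℝ) (hε : 0 < ε) (φ : U ≃ₜ StarGlue v ε) (hx : x ∈ U),
    ∀ i : Fin v, φ ⟨x, hx⟩ = Quotient.mk (starSetoid v ε) (i, ⟨0, le_rfl, hε⟩)

/-- A metric graph: a compact length space in which every point has a star-shaped
neighbourhood. -/
def IsMetricGraph (X : Type*) [MetricSpace X] : Prop :=
  CompactSpace X ∧
  (∀ x y : X, edist x y = ⨅ g : Path x y, pathLength g) ∧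
  ∀ x : X, ∃ (v : ℕ) (U : Set X), U ∈ nhds x ∧ IsStarNbhdOf x v U

/-- `x` has valence `v`. -/
def HasValence (x : G) (v : ℕ) : Prop :=
  ∃ U ∈ nhds x, IsStarNbhdOf x v U

/-! ### Rational functions, tangent directions, orders and divisors -/

/-- `g` is a unit speed (isometric) path of length `ε` starting at `x`. -/
def IsUnitSpeedFrom (x : G) (ε : ℝ) (g : ℝ → G) : Prop :=
  g 0 = x ∧ ∀ s ∈ Set.Ico (0:ℝ) ε, ∀ t ∈ Set.Ico (0:ℝ) ε, dist (g s) (g t) = |s - t|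

/-- `f` has (integer) slope `s` along the path `g` near its starting point. -/
def HasSlopeAlong (f : G → ℝ) (g : ℝ → G) (s : ℤ) : Prop :=
  ∃ δ > (0:ℝ), ∀ t ∈ Set.Ico (0:ℝ) δ, f (g t) = f (g 0) + s * t

/-- A rational function: continuous, and linear with integer slope along every direction
near every point.  (On a compact metric graph this coincides with being continuous
piecewise linear with integer slopes.) -/
def IsRational (f : G → ℝ) : Prop :=
  Continuous f ∧ ∀ (x : G) (ε : ℝ) (g : ℝ → G), 0 < ε → IsUnitSpeedFrom x ε g →
    ∃ s : ℤ, HasSlopeAlong f g s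

/-- Unit speed paths emanating from `x`. -/
def UnitPath (x : G) : Type _ :=
  {g : ℝ → G // ∃ ε > (0:ℝ), IsUnitSpeedFrom x ε g}

/-- Two unit speed paths are equivalent when they agree near `0`. -/
def germSetoid (x : G) : Setoid (UnitPath x) where
  r g₁ g₂ := ∃ δ > (0:ℝ), ∀ t ∈ Set.Ico (0:ℝ) δ, g₁.1 t = g₂.1 t
  iseqv := by
    constructor
    · intro g
      obtain ⟨ε, hε, _⟩ := g.2
      exact ⟨ε, hε, fun t _ => rfl⟩
    · rintro g₁ g₂ ⟨δ, hδ, h⟩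
      exact ⟨δ, hδ, fun t ht => (h t ht).symm⟩
    · rintro g₁ g₂ g₃ ⟨δ₁, hδ₁, h₁⟩ ⟨δ₂, hδ₂, h₂⟩
      refine ⟨min δ₁ δ₂, lt_min hδ₁ hδ₂, fun t ht => ?_⟩
      have ht' := Set.mem_Ico.mp ht
      rw [h₁ t (Set.mem_Ico.mpr ⟨ht'.1, lt_of_lt_of_le ht'.2 (min_le_left _ _)⟩),
        h₂ t (Set.mem_Ico.mpr ⟨ht'.1, lt_of_lt_of_le ht'.2 (min_le_right _ _)⟩)]

/-- The set of (unit) tangent directions at `x`: germs of unit speed paths from `x`. -/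
def TangentDir (x : G) : Type _ :=
  Quotient (germSetoid x)

open scoped Classical in
/-- The outgoing slope of `f` along a tangent direction. -/
noncomputable def tangentSlope (f : G → ℝ) {x : G} (ζ : TangentDir x) : ℤ :=
  if h : ∃ s : ℤ, HasSlopeAlong f (Quotient.out ζ).1 s then h.choose else 0

/-- The order of `f` at `x`: the sum of the outgoing slopes of `f` at `x`. -/
noncomputable def ordAt (f : G → ℝ) (x : G) : ℤ :=
  ∑ᶠ ζ : TangentDir x, tangentSlope f ζ

/-- Divisors are represented as finitely supported functions `G → ℤ`. -/
def FinSupp (D : G → ℤ) : Prop :=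
  (Function.support D).Finite

/-- A divisor is effective when all its coefficients are nonnegative. -/
def Effective (D : G → ℤ) : Prop :=
  ∀ x, 0 ≤ D x

/-- The degree of a divisor. -/
noncomputable def deg (D : G → ℤ) : ℤ :=
  ∑ᶠ x, D x

/-- The degree of the restriction of a divisor to a subset. -/
noncomputable def degOn (S : Set G) (D : G → ℤ) : ℤ :=
  ∑ᶠ x ∈ S, D x

/-- Linear equivalence of divisors: the difference is the divisor of a rational function. -/
def LinEquiv (D D' : G → ℤ) : Prop :=
  ∃ f : G → ℝ, IsRational f ∧ ∀ x, D' x = D x + ordAt f x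

/-- `R(D)`: rational functions `f` with `D + div f ≥ 0`. -/
def RD (D : G → ℤ) : Set (G → ℝ) :=
  {f | IsRational f ∧ ∀ x, 0 ≤ D x + ordAt f x}

/-- The complete linear system `|D₀|` of effective divisors linearly equivalent to `D₀`. -/
def LinSys (D₀ : G → ℤ) : Set (G → ℤ) :=
  {D | FinSupp D ∧ Effective D ∧ LinEquiv D₀ D}

/-- The oscillation `max f - min f` of a function. -/
noncomputable def osc (f : G → ℝ) : ℝ :=
  sSup (Set.range f) - sInf (Set.range f)

/-- The distance `d_∞` on a complete linear system. -/
noncomputable def linDist (D₁ D₂ : G → ℤ) : ℝ :=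
  sInf {r : ℝ | ∃ f : G → ℝ, IsRational f ∧ (∀ x, D₂ x = D₁ x + ordAt f x) ∧ r = osc f}

/-- `f` is constant on `S`. -/
def ConstOn (f : G → ℝ) (S : Set G) : Prop :=
  ∀ x ∈ S, ∀ y ∈ S, f x = f y

/-! ### Subgraphs, arcs, components, firing -/

/-- An open arc: the isometric image of a nonempty open interval. -/
def IsOpenArc (S : Set G) : Prop :=
  ∃ (a b : ℝ) (g : ℝ → G), a < b ∧
    (∀ s ∈ Set.Ioo a b, ∀ t ∈ Set.Ioo a b, dist (g s) (g t) = |s - t|) ∧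
    S = g '' Set.Ioo a b

/-- The set of connected components of a subset. -/
def compsOf (S : Set G) : Set (Set G) :=
  {C | ∃ x ∈ S, C = connectedComponentIn S x}

/-- The outgoing degree of `x` with respect to a closed subgraph `Z`:
the number of tangent directions at `x` leaving `Z`. -/
noncomputable def degOut (Z : Set G) (x : G) : ℕ :=
  Nat.card {ζ : TangentDir x //
    ∃ δ > (0:ℝ), ∀ t ∈ Set.Ioo (0:ℝ) δ, (Quotient.out ζ).1 t ∉ interior Z}

/-- A closed subgraph `Z` can fire with respect to `D` when `D(x) ≥ deg^out_Z(x)` for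
all `x` on the boundary of `Z`. -/
def CanFire (D : G → ℤ) (Z : Set G) : Prop :=
  Z.Nonempty ∧ IsClosed Z ∧ (compsOf Z).Finite ∧
  ∀ x ∈ frontier Z, (degOut Z x : ℤ) ≤ D x

/-- A `v`-reduced divisor. -/
def IsReduced (v : G) (D : G → ℤ) : Prop :=
  (∀ x, x ≠ v → 0 ≤ D x) ∧ ∀ Z : Set G, v ∉ Z → ¬CanFire D Z

/-- `D` is `V`-unsaturated: no closed subgraph whose boundary meets `V` can fire. -/
def Unsaturated (V : Set G) (D : G → ℤ) : Prop :=
  ¬∃ Z : Set G, (frontier Z ∩ V).Nonempty ∧ CanFire D Z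

/-- A local maximum of `f`: a closed connected set on which `f` is constant, with a
neighbourhood on which `f` is strictly smaller outside of it. -/
def IsLocalMaxSet (f : G → ℝ) (C : Set G) : Prop :=
  IsClosed C ∧ IsConnected C ∧ ConstOn f C ∧
  ∃ U, IsOpen U ∧ C ⊆ U ∧ ∀ x ∈ U \ C, ∀ y ∈ C, f x < f y

/-! ### Models and genus -/

/-- A model of the metric graph: a finite set of vertices whose complement is a finite
disjoint union of open arcs. -/
def IsGraphModel (V : Set G) : Prop :=
  V.Finite ∧ (compsOf Vᶜ).Finite ∧ ∀ C ∈ compsOf Vᶜ, IsOpenArc C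

/-- A model has no self-loops: the closure of each open edge contains two distinct
endpoints. -/
def LoopFree (V : Set G) : Prop :=
  ∀ C ∈ compsOf Vᶜ, (closure C \ C).ncard = 2

/-- A model of an open subgraph `U`, together with valences of its vertices inside `U`. -/
def IsModelIn (U V : Set G) (val : G → ℕ) : Prop :=
  V ⊆ U ∧ V.Finite ∧
  (∀ x ∈ V, ∃ W ∈ nhds x, W ⊆ U ∧ IsStarNbhdOf x (val x) W) ∧
  (compsOf (U \ V)).Finite ∧ (∀ C ∈ compsOf (U \ V), IsOpenArc C) ∧
  (compsOf U).Finite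

/-- The genus (first Betti number) of an open subgraph `U`, i.e. of its completion:
computed from any model as `Σ val(x) - #edges - #vertices + #components`. -/
def HasGenusOpen (U : Set G) (g : ℤ) : Prop :=
  ∃ (V : Set G) (val : G → ℕ), IsModelIn U V val ∧
    g = (∑ᶠ x ∈ V, (val x : ℤ)) - ((compsOf (U \ V)).ncard : ℤ)
        - (V.ncard : ℤ) + ((compsOf U).ncard : ℤ)

/-! ### Chip firing moves -/

/-- The open `ε`-neighbourhood of `Z`. -/
def ZNbhd (Z : Set G) (ε : ℝ) : Set G :=
  {x | Metric.infDist x Z < ε}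

/-- The chip firing function `CF(Z, ε)`. -/
noncomputable def CF (Z : Set G) (ε : ℝ) : G → ℝ :=
  fun x => -min (Metric.infDist x Z) ε

/-- The data of a chip firing move: a closed subgraph with finitely many components such
that `Z_ε \ Z` is a disjoint union of open intervals. -/
def ChipData (Z : Set G) (ε : ℝ) : Prop :=
  IsClosed Z ∧ Z.Nonempty ∧ (compsOf Z).Finite ∧
  ∀ C ∈ compsOf (ZNbhd Z ε \ Z), IsOpenArc C

/-- `h` is a chip firing move. -/
def IsCFMove (h : G → ℝ) : Prop :=
  ∃ (Z : Set G) (ε : ℝ), 0 < ε ∧ ChipData Z ε ∧ h = CF Z ε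

/-- `f` is linear (with some real slope) on the open arc `C`. -/
def LinearOnArc (f : G → ℝ) (C : Set G) : Prop :=
  ∃ (a b : ℝ) (g : ℝ → G) (s c : ℝ), a < b ∧
    (∀ u ∈ Set.Ioo a b, ∀ t ∈ Set.Ioo a b, dist (g u) (g t) = |u - t|) ∧
    C = g '' Set.Ioo a b ∧ ∀ t ∈ Set.Ioo a b, f (g t) = s * t + c

/-- A weighted chip firing move. -/
def IsWeightedCF (f : G → ℝ) : Prop :=
  IsRational f ∧ (¬∀ x y : G, f x = f y) ∧
  ∃ Z₁ Z₂ : Set G, IsClosed Z₁ ∧ IsClosed Z₂ ∧ Z₁.Nonempty ∧ Z₂.Nonempty ∧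
    Disjoint Z₁ Z₂ ∧ Z₁ ≠ Set.univ ∧ Z₂ ≠ Set.univ ∧
    (∀ C ∈ compsOf (Z₁ ∪ Z₂)ᶜ, IsOpenArc C) ∧
    ConstOn f Z₁ ∧ ConstOn f Z₂ ∧
    ∀ C ∈ compsOf (Z₁ ∪ Z₂)ᶜ, LinearOnArc f C

/-! ### Cells of the complete linear system -/

/-- The part of the support of a divisor lying in the interiors of the edges. -/
def edgeSupp (V : Set G) (D : G → ℤ) : Set G :=
  {x | x ∉ V ∧ D x ≠ 0}

/-- The dimension of the cell of `|D₀|` containing `D` in its relative interior: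
the number of connected components of `Γ ∖ supp D_E`, minus one. -/
noncomputable def cellDim (V : Set G) (D : G → ℤ) : ℤ :=
  ((compsOf (edgeSupp V D)ᶜ).ncard : ℤ) - 1

/-- Two divisors of `|D₀|` have the same combinatorial type with respect to the model `V`
(they lie in the relative interior of the same cell): equal multiplicities on the
vertices, chip configurations on the edges related by a homeomorphism fixing the
vertices and each edge, and equal slopes at all tangent directions at the vertices. -/
def SameType (V : Set G) (D₀ D₁ D₂ : G → ℤ) : Prop :=
  (∀ v ∈ V, D₁ v = D₂ v) ∧
  (∃ h : G ≃ₜ G, (∀ v ∈ V, h v = v) ∧ (∀ x ∉ V, h x ∈ connectedComponentIn Vᶜ x) ∧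
    ∀ x, D₂ (h x) = D₁ x) ∧
  (∃ f₁ f₂ : G → ℝ, IsRational f₁ ∧ IsRational f₂ ∧
    (∀ x, D₁ x = D₀ x + ordAt f₁ x) ∧ (∀ x, D₂ x = D₀ x + ordAt f₂ x) ∧
    ∀ v ∈ V, ∀ ζ : TangentDir v, tangentSlope f₁ ζ = tangentSlope f₂ ζ)

/-- `D'` lies in the closed cell `Δ_D` of `|D₀|`. -/
def InClosedCell (V : Set G) (D₀ D D' : G → ℤ) : Prop :=
  ∀ ε > (0:ℝ), ∃ D'' : G → ℤ, SameType V D₀ D D'' ∧ linDist D' D'' < ε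

/-- `D` is generic in `|D₀|`: it lies in the relative interior of an inclusion-wise
maximal cell, i.e. all sufficiently nearby divisors of `|D₀|` lie in the closed cell
of `D`. -/
def Generic (V : Set G) (D₀ D : G → ℤ) : Prop :=
  D ∈ LinSys D₀ ∧ ∃ ε > (0:ℝ), ∀ D' ∈ LinSys D₀, linDist D D' < ε → InClosedCell V D₀ D D'

/-- The rank of `D` is at least `d`: for every effective divisor `E` of degree `d`,
`|D - E|` is nonempty. -/
def rankGe (D : G → ℤ) (d : ℕ) : Prop :=
  ∀ E : G → ℤ, FinSupp E → Effective E → deg E = (d : ℤ) →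
    ∃ D' : G → ℤ, FinSupp D' ∧ Effective D' ∧ LinEquiv (fun x => D x - E x) D'

/-! ### Cycles, the canonical divisor and realizability -/

/-- A simple cycle: a subset homeomorphic to a circle. -/
def IsCycleSet (C : Set G) : Prop :=
  Nonempty (C ≃ₜ AddCircle (1 : ℝ))

/-- The canonical divisor `K + div f` for a vertex valence function `val`. -/
noncomputable def canDiv (val : G → ℕ) (f : G → ℝ) : G → ℤ :=
  fun x => (val x : ℤ) - 2 + ordAt f x

/-- The enhanced-level-graph invariant `k(ζ) = -s_ζ(f) - 1` of a tangent direction. -/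
noncomputable def kVal (f : G → ℝ) {v : G} (ζ : TangentDir v) : ℤ :=
  -(tangentSlope f ζ) - 1

/-- `v` is an inconvenient vertex of the enhanced level graph `Γ⁺(f)` (all vertex
weights `h ≡ 0`): no `k`-value equals `-1`, and some `k`-value (of a half-edge, or of
one of the `D(v)` attached legs, which carry `k = 1`) exceeds
`Σ_{k_j < 0} (-k_j) - #{k_j < 0} - 1`.  (Legs have `k = 1 > 0` and so never contribute
to the sums, and their `k`-value is `≠ -1`.) -/
def Inconvenient (val : G → ℕ) (f : G → ℝ) (v : G) : Prop :=
  (∀ ζ : TangentDir v, kVal f ζ ≠ -1) ∧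
  ∃ k₀ : ℤ, ((∃ ζ : TangentDir v, kVal f ζ = k₀) ∨ (0 < canDiv val f v ∧ k₀ = 1)) ∧
    (∑ᶠ ζ ∈ {ζ : TangentDir v | kVal f ζ < 0}, (-kVal f ζ))
      - (({ζ : TangentDir v | kVal f ζ < 0}).ncard : ℤ) - 1 < k₀

/-- The realizability criterion of Möller–Ulirsch–Werner for the effective canonical
divisor `K + div f`: every inconvenient vertex, and every open arc on which `f` is
constant, away from the bends of `f` and from higher-valence points, is contained in a
simple cycle lying above it. -/
def RealizableFn (val : G → ℕ) (f : G → ℝ) : Prop :=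
  (∀ v, Inconvenient val f v →
    ∃ Z : Set G, IsCycleSet Z ∧ v ∈ Z ∧ ∀ z ∈ Z, f v ≤ f z) ∧
  (∀ A : Set G, IsOpenArc A → ConstOn f A → (∀ x ∈ A, ordAt f x = 0 ∧ val x = 2) →
    ∃ Z : Set G, IsCycleSet Z ∧ A ⊆ Z ∧ ∀ z ∈ Z, ∀ a ∈ A, f a ≤ f z)

/-- The realizability locus inside the canonical linear system. -/
def RealSet (val : G → ℕ) : Set (G → ℤ) :=
  {D | ∃ f : G → ℝ, IsRational f ∧ (∀ x, D x = (val x : ℤ) - 2 + ordAt f x) ∧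
    RealizableFn val f}

/-! ### Tropical linear series -/

/-- The cone `R(𝔡, D)` of rational functions `f` with `D + div f ∈ 𝔡`. -/
def coneOf (D : G → ℤ) (𝔡 : Set (G → ℤ)) : Set (G → ℝ) :=
  {f | IsRational f ∧ (fun x => D x + ordAt f x) ∈ 𝔡}

/-- A tropical linear series: a tropically convex subset of a complete linear system,
i.e. one whose cone of rational functions is a tropical submodule. -/
def TropLinearSeries (D₀ : G → ℤ) (𝔡 : Set (G → ℤ)) : Prop :=
  𝔡 ⊆ LinSys D₀ ∧
  (∀ f ∈ coneOf D₀ 𝔡, ∀ g ∈ coneOf D₀ 𝔡, (fun x => max (f x) (g x)) ∈ coneOf D₀ 𝔡) ∧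
  (∀ c : ℝ, ∀ f ∈ coneOf D₀ 𝔡, (fun x => c + f x) ∈ coneOf D₀ 𝔡)

/-- The rank of the tropical linear series `𝔡` is at least `d`:
`𝔡(-E)` is nonempty for every effective divisor `E` of degree `d`. -/
def lsRankGe (𝔡 : Set (G → ℤ)) (d : ℕ) : Prop :=
  ∀ E : G → ℤ, FinSupp E → Effective E → deg E = (d : ℤ) →
    ∃ D ∈ 𝔡, ∀ x, E x ≤ D x

/-- `D` splits in `𝔡`: some non-constant `f ∈ R(𝔡, D)`, with maximum locus `Z`, has a
boundary point `x ∈ ∂Z` with `D(x) + ord_x(f) > 0`. -/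
def Splits (𝔡 : Set (G → ℤ)) (D : G → ℤ) : Prop :=
  ∃ f ∈ coneOf D 𝔡, (¬∀ x y : G, f x = f y) ∧
    ∃ x ∈ frontier {y | ∀ z, f z ≤ f y}, 0 < D x + ordAt f x

/-- The pairing of a divisor with a test function. -/
noncomputable def pairing (D : G → ℤ) (φ : G → ℝ) : ℝ :=
  ∑ᶠ x, (D x : ℝ) * φ x

/-- The tangent space of `X` at `D` has dimension at least `r`: there are `r`
one-sided differentiable paths through `D` inside `X` whose derivatives (as linear
functionals on rational test functions) are linearly independent. -/
def TangentDimGe (X : Set (G → ℤ)) (D : G → ℤ) (r : ℕ) : Prop :=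
  ∃ (c : Fin r → ℝ → G → ℤ) (L : Fin r → (G → ℝ) → ℝ) (ε : ℝ), 0 < ε ∧
    (∀ i, c i 0 = D) ∧ (∀ i, ∀ t ∈ Set.Ico (0:ℝ) ε, c i t ∈ X) ∧
    (∀ i, ∀ φ : G → ℝ, IsRational φ →
      HasDerivWithinAt (fun t => pairing (c i t) φ) (L i φ) (Set.Ici 0) 0) ∧
    LinearIndependent ℝ L


/-! ### Local coordinates on star-shaped neighbourhoods -/

open scoped Classical in
/-- The distance from the centre along the branch `i`, extended by zero to the other branches. -/
noncomputable def starCoord {n : ℕ} {ε : ℝ} (i : Fin n) : StarGlue n ε → ℝ :=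
  Quotient.lift (s := starSetoid n ε) (fun a => if a.1 = i then (a.2 : ℝ) else 0) (by
    rintro a b (rfl | ⟨ha, hb⟩)
    · rfl
    · simp [ha, hb])

lemma continuous_starCoord {n : ℕ} {ε : ℝ} (i : Fin n) :
    Continuous (starCoord (ε := ε) i) := by
  refine Continuous.quotient_lift (s := starSetoid n ε) ?_ _
  rw [continuous_prod_of_discrete_left]
  intro j
  by_cases h : j = i
  · simpa [h] using continuous_subtype_val
  · simpa [h] using continuous_const

/-- Parametrizations `p i` and coordinates `c i` of the branches of a star-shaped
neighbourhood `U` of `x`. -/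
structure IsStarChart (x : G) {n : ℕ} (U : Set G) (ε : ℝ) (p : Fin n → ℝ → G)
    (c : Fin n → G → ℝ) : Prop where
  pos : 0 < ε
  mem_nhds : U ∈ nhds x
  param_zero : ∀ i, p i 0 = x
  param_mem : ∀ i, ∀ s ∈ Ico (0 : ℝ) ε, p i s ∈ U
  continuousOn_param : ∀ i, ContinuousOn (p i) (Ico 0 ε)
  continuousOn_coord : ∀ i, ContinuousOn (c i) U
  coord_param : ∀ i, ∀ s ∈ Ico (0 : ℝ) ε, c i (p i s) = s
  param_coord : ∀ i, ∀ y ∈ U, 0 < c i y → p i (c i y) = y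
  exists_param : ∀ y ∈ U, ∃ i, ∃ s ∈ Ico (0 : ℝ) ε, y = p i s

lemma IsStarNbhdOf.exists_chart {x : G} {n : ℕ} {U : Set G} (hU : U ∈ nhds x)
    (h : IsStarNbhdOf x n U) :
    ∃ (ε : ℝ) (p : Fin n → ℝ → G) (c : Fin n → G → ℝ), IsStarChart x U ε p c := by
  classical
  obtain ⟨ε, hε, φ, hx, hφ⟩ := h
  let q : Fin n → Ico (0 : ℝ) ε → G := fun i s =>
    (φ.symm (Quotient.mk (starSetoid n ε) (i, s)) : G)
  let p : Fin n → ℝ → G := fun i s => if h : s ∈ Ico (0 : ℝ) ε then q i ⟨s, h⟩ else x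
  let c : Fin n → G → ℝ := fun i y => if h : y ∈ U then starCoord i (φ ⟨y, h⟩) else 0
  have hp : ∀ i s (h : s ∈ Ico (0 : ℝ) ε), p i s = q i ⟨s, h⟩ := fun i s h => dif_pos h
  have hc : ∀ i y (h : y ∈ U), c i y = starCoord i (φ ⟨y, h⟩) := fun i y h => dif_pos h
  have hpU : ∀ i, ∀ s ∈ Ico (0 : ℝ) ε, p i s ∈ U := fun i s h => by
    rw [hp i s h]; exact Subtype.coe_prop _
  have hex : ∀ y (h : y ∈ U), ∃ i, ∃ s : Ico (0 : ℝ) ε,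
      φ ⟨y, h⟩ = Quotient.mk (starSetoid n ε) (i, s) ∧ y = p i s := by
    intro y h
    obtain ⟨⟨i, s⟩, hs⟩ := Quotient.exists_rep (s := starSetoid n ε) (φ ⟨y, h⟩)
    refine ⟨i, s, hs.symm, ?_⟩
    rw [hp i s s.2]
    change y = (φ.symm (Quotient.mk (starSetoid n ε) (i, s)) : G)
    rw [hs, φ.symm_apply_apply]
  refine ⟨ε, p, c, hε, hU, ?_, hpU, ?_, ?_, ?_, ?_, ?_⟩
  · intro i
    rw [hp i 0 ⟨le_rfl, hε⟩]
    change (φ.symm (Quotient.mk (starSetoid n ε) (i, ⟨0, le_rfl, hε⟩)) : G) = x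
    rw [← hφ i, φ.symm_apply_apply]
  · intro i
    rw [continuousOn_iff_continuous_domRestrict]
    have : (Ico (0 : ℝ) ε).domRestrict (p i) = q i := by
      ext s; exact hp i s s.2
    rw [this]
    have hm : Continuous (Quotient.mk (starSetoid n ε)) := continuous_quotient_mk'
    exact continuous_subtype_val.comp (φ.symm.continuous.comp
      (hm.comp (Continuous.prodMk_right i)))
  · intro i
    rw [continuousOn_iff_continuous_domRestrict]
    have : U.domRestrict (c i) = starCoord i ∘ φ := by
      ext y; exact hc i y y.2
    rw [this]
    exact (continuous_starCoord i).comp φ.continuous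
  · intro i s hs
    have h1 : φ ⟨p i s, hpU i s hs⟩ = Quotient.mk (starSetoid n ε) (i, ⟨s, hs⟩) := by
      rw [← φ.apply_symm_apply (Quotient.mk (starSetoid n ε) (i, ⟨s, hs⟩))]
      congr 1
      exact Subtype.ext (hp i s hs)
    rw [hc i _ (hpU i s hs), h1]
    simp [starCoord]
  · intro i y hy hpos
    obtain ⟨j, s, hs, hys⟩ := hex y hy
    have h1 : c i y = if j = i then (s : ℝ) else 0 := by
      rw [hc i y hy, hs]; simp [starCoord]
    by_cases hji : j = i
    · subst hji
      rw [h1, if_pos rfl, hys]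
    · rw [h1, if_neg hji] at hpos
      exact absurd hpos (lt_irrefl _)
  · intro y hy
    obtain ⟨i, s, -, hys⟩ := hex y hy
    exact ⟨i, s, s.2, hys⟩

lemma IsMetricGraph.exists_chart (hG : IsMetricGraph G) (x : G) :
    ∃ (n : ℕ) (U : Set G) (ε : ℝ) (p : Fin n → ℝ → G) (c : Fin n → G → ℝ),
      IsStarChart x U ε p c := by
  obtain ⟨n, U, hU, h⟩ := hG.2.2 x
  exact ⟨n, U, h.exists_chart hU⟩

lemma edist_add_edist_le_pathLength {x y : G} (γ : Path x y) (t : unitInterval) :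
    edist x (γ t) + edist (γ t) y ≤ pathLength γ := by
  have h := eVariationOn.Icc_add_Icc (fun s : ℝ => γ.extend s) (s := univ)
    t.2.1 t.2.2 (mem_univ _)
  simp only [univ_inter] at h
  unfold pathLength
  rw [← h]
  have h0 : γ.extend 0 = x := by simp
  have h1 : γ.extend 1 = y := by simp
  have ht : γ.extend (t : ℝ) = γ t := by simp
  refine add_le_add ?_ ?_
  · have := eVariationOn.edist_le (fun s : ℝ => γ.extend s) (s := Icc 0 (t : ℝ))
      (left_mem_Icc.2 t.2.1) (right_mem_Icc.2 t.2.1)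
    simpa only [h0, ht] using this
  · have := eVariationOn.edist_le (fun s : ℝ => γ.extend s) (s := Icc (t : ℝ) 1)
      (left_mem_Icc.2 t.2.2) (right_mem_Icc.2 t.2.2)
    simpa only [h1, ht] using this

lemma IsMetricGraph.exists_path_dist_lt (hG : IsMetricGraph G) (x y : G) {η : ℝ} (hη : 0 < η) :
    ∃ γ : Path x y, ∀ t, dist x (γ t) + dist (γ t) y < dist x y + η := by
  have hlt : (⨅ γ : Path x y, pathLength γ) < ENNReal.ofReal (dist x y + η) := by
    rw [← hG.2.1, edist_dist]
    exact ENNReal.ofReal_lt_ofReal_iff'.2 ⟨by linarith, by positivity⟩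
  obtain ⟨γ, hγ⟩ := iInf_lt_iff.1 hlt
  refine ⟨γ, fun t => ?_⟩
  have h := (edist_add_edist_le_pathLength γ t).trans_lt hγ
  rw [edist_dist, edist_dist, ← ENNReal.ofReal_add dist_nonneg dist_nonneg] at h
  exact (ENNReal.ofReal_lt_ofReal_iff'.1 h).1

namespace IsStarChart

variable {x : G} {n : ℕ} {U : Set G} {ε : ℝ} {p : Fin n → ℝ → G} {c : Fin n → G → ℝ}

lemma coord_center (h : IsStarChart x U ε p c) (i : Fin n) : c i x = 0 := by
  have := h.coord_param i 0 ⟨le_rfl, h.pos⟩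
  rwa [h.param_zero] at this

/-- Every path from the centre that stays in a star-shaped neighbourhood runs through the
branch that leads to its endpoint. -/
lemma exists_eq_param (h : IsStarChart x U ε p c) {i : Fin n} {s τ a b : ℝ}
    {γ : ℝ → G} (hab : a ≤ b) (hγ : ContinuousOn γ (Icc a b)) (hU : ∀ t ∈ Icc a b, γ t ∈ U)
    (ha : γ a = x) (hb : c i (γ b) = s) (hτ : τ ∈ Ioc 0 s) :
    ∃ t ∈ Icc a b, γ t = p i τ := by
  have hcont : ContinuousOn (c i ∘ γ) (Icc a b) := (h.continuousOn_coord i).comp hγ hU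
  have hmem : τ ∈ Icc ((c i ∘ γ) a) ((c i ∘ γ) b) := by
    simp only [comp_apply, ha, hb, h.coord_center]
    exact ⟨hτ.1.le, hτ.2⟩
  obtain ⟨t, ht, hct⟩ := intermediate_value_Icc hab hcont hmem
  have hct' : c i (γ t) = τ := hct
  refine ⟨t, ht, ?_⟩
  rw [← hct', h.param_coord i _ (hU t ht) (by rw [hct']; exact hτ.1)]

lemma dist_param (h : IsStarChart x U ε p c) (hG : IsMetricGraph G) {r : ℝ}
    (hr : Metric.ball x r ⊆ U) {i : Fin n} {τ s : ℝ} (hτ : 0 ≤ τ) (hτs : τ ≤ s) (hs : s < ε)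
    (hsr : dist x (p i s) < r) :
    dist (p i τ) (p i s) = dist x (p i s) - dist x (p i τ) := by
  have htri := dist_triangle x (p i τ) (p i s)
  suffices dist x (p i τ) + dist (p i τ) (p i s) ≤ dist x (p i s) by linarith
  rcases hτ.eq_or_lt with rfl | hτ0
  · simp [h.param_zero]
  refine le_of_forall_pos_lt_add fun η hη => ?_
  obtain ⟨γ, hγ⟩ := hG.exists_path_dist_lt x (p i s)
    (lt_min hη (sub_pos.2 hsr))
  have hU : ∀ t ∈ Icc (0 : ℝ) 1, γ.extend t ∈ U := by
    intro t ht
    apply hr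
    have h1 := hγ ⟨t, ht⟩
    rw [γ.extend_apply ht, Metric.mem_ball, dist_comm]
    have := min_le_right η (r - dist x (p i s))
    have := dist_nonneg (x := γ ⟨t, ht⟩) (y := p i s)
    linarith
  obtain ⟨t, ht, hpt⟩ := h.exists_eq_param (i := i) (s := s) (τ := τ) zero_le_one
    γ.continuous_extend.continuousOn hU γ.extend_zero
    (by rw [γ.extend_one, h.coord_param i s ⟨hτ.trans hτs, hs⟩]) ⟨hτ0, hτs⟩
  have h1 := hγ ⟨t, ht⟩
  rw [← γ.extend_apply ht, hpt] at h1
  exact h1.trans_le (by gcongr; exact min_le_left _ _)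

/-- Along each branch, a rational function is linear near the centre in terms of the distance. -/
lemma exists_slope (h : IsStarChart x U ε p c) (hG : IsMetricGraph G) {f : G → ℝ}
    (hf : IsRational f) (i : Fin n) :
    ∃ η > (0 : ℝ), η ≤ ε ∧ ∃ m : ℤ, ∀ s ∈ Ico (0 : ℝ) η,
      f (p i s) = f x + m * dist x (p i s) := by
  obtain ⟨r, hr, hrU⟩ := Metric.mem_nhds_iff.1 h.mem_nhds
  have hρ : ContinuousOn (fun s => dist x (p i s)) (Ico 0 ε) :=
    Continuous.comp_continuousOn (g := dist x) (by fun_prop) (h.continuousOn_param i)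
  have small : ∀ δ > (0 : ℝ), ∃ η > (0 : ℝ), η ≤ ε ∧ ∀ s ∈ Ico (0 : ℝ) η,
      dist x (p i s) < δ := by
    intro δ hδ
    obtain ⟨η, hη, hlt⟩ := Metric.continuousWithinAt_iff.1
      ((h.continuousOn_param i) 0 ⟨le_rfl, h.pos⟩) δ hδ
    refine ⟨min η ε, lt_min hη h.pos, min_le_right _ _, fun s hs => ?_⟩
    have := hlt (x := s) ⟨hs.1, hs.2.trans_le (min_le_right _ _)⟩ (by
      rw [Real.dist_eq, sub_zero, abs_of_nonneg hs.1]
      exact hs.2.trans_le (min_le_left _ _))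
    rwa [h.param_zero, dist_comm] at this
  obtain ⟨η₀, hη₀, hη₀ε, hη₀r⟩ := small r hr
  set b := η₀ / 2 with hb
  have hb0 : 0 < b := by positivity
  have hbη : b < η₀ := by linarith
  have hdist : ∀ s ∈ Icc (0 : ℝ) b, ∀ t ∈ Icc (0 : ℝ) b,
      dist (p i s) (p i t) = |dist x (p i s) - dist x (p i t)| := by
    have key : ∀ s t : ℝ, 0 ≤ s → s ≤ t → t ≤ b →
        dist (p i s) (p i t) = dist x (p i t) - dist x (p i s) := fun s t h0 hst ht =>
      h.dist_param hG hrU h0 hst (by linarith) (hη₀r t ⟨h0.trans hst, by linarith⟩)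
    intro s hs t ht
    rcases le_total s t with hst | hst
    · have := key s t hs.1 hst ht.2
      rw [abs_sub_comm, abs_of_nonneg (this ▸ dist_nonneg), this]
    · have := key t s ht.1 hst hs.2
      rw [abs_of_nonneg (this ▸ dist_nonneg), dist_comm, this]
  have hℓ : 0 < dist x (p i b) := by
    rw [dist_pos]
    intro hx
    have h1 := h.coord_param i b ⟨hb0.le, by linarith⟩
    rw [← hx, h.coord_center] at h1
    linarith
  have hsurj : ∀ u ∈ Icc (0 : ℝ) (dist x (p i b)), ∃ s ∈ Icc (0 : ℝ) b, dist x (p i s) = u := by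
    intro u hu
    refine intermediate_value_Icc hb0.le
      (hρ.mono fun s hs => ⟨hs.1, by linarith [hs.2]⟩) ?_
    simpa [h.param_zero] using hu
  choose! σ hσmem hσ using hsurj
  have hspeed : IsUnitSpeedFrom x (dist x (p i b)) (fun u => p i (σ u)) := by
    refine ⟨?_, fun s hs t ht => ?_⟩
    · exact (dist_eq_zero.1 (hσ 0 ⟨le_rfl, hℓ.le⟩)).symm
    · have hs' := Ico_subset_Icc_self hs
      have ht' := Ico_subset_Icc_self ht
      rw [hdist _ (hσmem s hs') _ (hσmem t ht'), hσ s hs', hσ t ht']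
  obtain ⟨m, δ, hδ, hm⟩ := hf.2 x _ _ hℓ hspeed
  obtain ⟨η₁, hη₁, hη₁ε, hη₁lt⟩ := small (min δ (dist x (p i b))) (lt_min hδ hℓ)
  refine ⟨min η₁ b, lt_min hη₁ hb0, (min_le_left _ _).trans hη₁ε, m, fun s hs => ?_⟩
  have hlt := hη₁lt s ⟨hs.1, hs.2.trans_le (min_le_left _ _)⟩
  have hsb : s ∈ Icc (0 : ℝ) b := ⟨hs.1, (hs.2.trans_le (min_le_right _ _)).le⟩
  have hu : dist x (p i s) ∈ Icc (0 : ℝ) (dist x (p i b)) :=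
    ⟨dist_nonneg, (hlt.trans_le (min_le_right _ _)).le⟩
  have heq : p i (σ (dist x (p i s))) = p i s := by
    rw [← dist_eq_zero, hdist _ (hσmem _ hu) _ hsb, hσ _ hu, sub_self, abs_zero]
  have h1 := hm _ ⟨dist_nonneg, hlt.trans_le (min_le_left _ _)⟩
  have h0 : p i (σ 0) = x := hspeed.1
  simp only [heq, h0] at h1
  exact h1

end IsStarChart

/-- If an isometric path from `x` stays in `Z`, it meets the interior of `Z` arbitrarily
close to `x`. -/
lemma IsMetricGraph.exists_mem_interior (hG : IsMetricGraph G) {x : G} {ε : ℝ} {g : ℝ → G}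
    (hε : 0 < ε) (hg : IsUnitSpeedFrom x ε g) {Z : Set G}
    (hZ : ∀ t ∈ Ico (0 : ℝ) ε, g t ∈ Z) :
    ∃ t ∈ Ioo (0 : ℝ) ε, g t ∈ interior Z := by
  obtain ⟨n, U, ε', p, c, h⟩ := hG.exists_chart x
  obtain ⟨r, hr, hrU⟩ := Metric.mem_nhds_iff.1 h.mem_nhds
  obtain ⟨b, hb0, hb⟩ := exists_between (lt_min hε hr)
  have hbε := hb.trans_le (min_le_left _ _)
  have hbr := hb.trans_le (min_le_right _ _)
  have hmem : ∀ t ∈ Icc (0 : ℝ) b, t ∈ Ico (0 : ℝ) ε := fun t ht => ⟨ht.1, ht.2.trans_lt hbε⟩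
  have hball : ∀ t ∈ Icc (0 : ℝ) b, g t ∈ Metric.ball x r := by
    intro t ht
    rw [Metric.mem_ball, ← hg.1, hg.2 t (hmem t ht) 0 ⟨le_rfl, hε⟩, sub_zero, abs_of_nonneg ht.1]
    exact ht.2.trans_lt hbr
  have hgU : ∀ t ∈ Icc (0 : ℝ) b, g t ∈ U := fun t ht => hrU (hball t ht)
  have hcont : ContinuousOn g (Icc 0 b) := by
    refine (LipschitzOnWith.of_dist_le_mul (K := 1) fun s hs t ht => ?_).continuousOn
    rw [hg.2 s (hmem s hs) t (hmem t ht), NNReal.coe_one, one_mul, Real.dist_eq]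
  have hbmem : b ∈ Icc (0 : ℝ) b := ⟨hb0.le, le_rfl⟩
  have hne : g b ≠ x := by
    rw [← dist_pos, ← hg.1, hg.2 b (hmem b hbmem) 0 ⟨le_rfl, hε⟩, sub_zero, abs_of_pos hb0]
    exact hb0
  obtain ⟨i, s, hs, hgb⟩ := h.exists_param (g b) (hgU b hbmem)
  have hs0 : 0 < s := by
    refine lt_of_le_of_ne hs.1 fun h0 => hne ?_
    rw [hgb, ← h0, h.param_zero]
  have hcb : c i (g b) = s := by rw [hgb, h.coord_param i s hs]
  have hmeet : ∀ τ ∈ Ioc 0 s, ∃ t ∈ Icc 0 b, g t = p i τ := fun τ hτ =>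
    h.exists_eq_param hb0.le hcont hgU hg.1 hcb hτ
  obtain ⟨t, ht, hgt⟩ := hmeet (s / 2) ⟨by positivity, by linarith⟩
  have hct : c i (g t) = s / 2 := by
    rw [hgt, h.coord_param i _ ⟨by positivity, by linarith [hs.2]⟩]
  have ht0 : t ≠ 0 := by
    rintro rfl
    rw [hg.1, h.coord_center] at hct
    linarith
  refine ⟨t, ⟨lt_of_le_of_ne ht.1 ht0.symm, ht.2.trans_lt hbε⟩, ?_⟩
  rw [mem_interior_iff_mem_nhds]
  have hU : U ∈ nhds (g t) :=
    Filter.mem_of_superset (Metric.isOpen_ball.mem_nhds (hball t ht)) hrU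
  have hev := ((h.continuousOn_coord i).continuousAt hU).preimage_mem_nhds
    (Ioo_mem_nhds (a := 0) (b := s) (by rw [hct]; positivity) (by rw [hct]; linarith))
  filter_upwards [hU, hev] with y hy hyc
  obtain ⟨t', ht', hgt'⟩ := hmeet (c i y) ⟨hyc.1, hyc.2.le⟩
  rw [h.param_coord i y hy hyc.1] at hgt'
  exact hgt' ▸ hZ t' (hmem t' ht')

/-! ### The maximum locus of a rational function -/

/-- The set where `f` attains its maximum. -/
def maxLocus (f : G → ℝ) : Set G :=
  {y | ∀ z, f z ≤ f y}

lemma isClosed_maxLocus {f : G → ℝ} (hf : Continuous f) : IsClosed (maxLocus f) := by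
  simp only [maxLocus, ofPred_forall]
  exact isClosed_iInter fun z => isClosed_le continuous_const hf

lemma IsMetricGraph.exists_nhds_maxLocus (hG : IsMetricGraph G) {f : G → ℝ} (hf : IsRational f)
    {x : G} (hx : x ∈ maxLocus f) :
    ∃ W ∈ nhds x, W ∩ maxLocus f ⊆ connectedComponentIn (maxLocus f) x := by
  obtain ⟨n, U, ε, p, c, h⟩ := hG.exists_chart x
  choose η hη hηε m hm using h.exists_slope hG hf
  have hW : ∀ᶠ y in nhds x, ∀ i, c i y < η i := by
    rw [Filter.eventually_all]
    intro i
    refine ((h.continuousOn_coord i).continuousAt h.mem_nhds).eventually_lt_const ?_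
    rw [h.coord_center]
    exact hη i
  refine ⟨U ∩ {y | ∀ i, c i y < η i}, Filter.inter_mem h.mem_nhds hW, ?_⟩
  rintro y ⟨⟨hyU, hyc⟩, hy⟩
  by_cases hyx : y = x
  · rw [hyx]; exact mem_connectedComponentIn hx
  obtain ⟨i, s, hs, rfl⟩ := h.exists_param y hyU
  have hsη : s < η i := by simpa [h.coord_param i s hs] using hyc i
  have hfy : f (p i s) = f x := le_antisymm (hx _) (hy _)
  have hm0 : (m i : ℝ) = 0 := by
    have h1 := hm i s ⟨hs.1, hsη⟩
    have h2 : dist x (p i s) ≠ 0 := fun h0 => hyx (dist_eq_zero.1 h0).symm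
    have h3 : (m i : ℝ) * dist x (p i s) = 0 := by linarith
    exact (mul_eq_zero.1 h3).resolve_right h2
  have hsub : p i '' Ico 0 (η i) ⊆ maxLocus f := by
    rintro _ ⟨t, ht, rfl⟩ z
    rw [hm i t ht, hm0, zero_mul, add_zero]
    exact hx z
  have hpre : IsPreconnected (p i '' Ico 0 (η i)) :=
    isPreconnected_Ico.image _
      ((h.continuousOn_param i).mono (Ico_subset_Ico_right (hηε i)))
  exact hpre.subset_connectedComponentIn ⟨0, ⟨le_rfl, hη i⟩, h.param_zero i⟩ hsub
    ⟨s, ⟨hs.1, hsη⟩, rfl⟩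

lemma IsMetricGraph.finite_compsOf_maxLocus (hG : IsMetricGraph G) {f : G → ℝ}
    (hf : IsRational f) : (compsOf (maxLocus f)).Finite := by
  have := hG.1
  choose! W hW hsub using fun x (hx : x ∈ maxLocus f) => hG.exists_nhds_maxLocus hf hx
  obtain ⟨t, ht, hcov⟩ := (isClosed_maxLocus hf.1).isCompact.elim_nhds_subcover W hW
  refine (t.finite_toSet.image (connectedComponentIn (maxLocus f))).subset ?_
  rintro _ ⟨x, hx, rfl⟩
  obtain ⟨y, hy, hxy⟩ := mem_iUnion₂.1 (hcov hx)
  exact ⟨y, hy, connectedComponentIn_eq (hsub y (ht y hy) ⟨hxy, hx⟩)⟩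

/-! ### Slopes at the maximum locus -/

lemma hasSlopeAlong_tangentSlope {f : G → ℝ} (hf : IsRational f) {x : G} (ζ : TangentDir x) :
    HasSlopeAlong f (Quotient.out ζ).1 (tangentSlope f ζ) := by
  obtain ⟨ε, hε, hg⟩ := (Quotient.out ζ).2
  have h := hf.2 x ε _ hε hg
  rw [tangentSlope, dif_pos h]
  exact h.choose_spec

lemma tangentSlope_nonpos {f : G → ℝ} (hf : IsRational f) {x : G} (hx : x ∈ maxLocus f)
    (ζ : TangentDir x) : tangentSlope f ζ ≤ 0 := by
  obtain ⟨δ, hδ, h⟩ := hasSlopeAlong_tangentSlope hf ζ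
  obtain ⟨ε, hε, hg⟩ := (Quotient.out ζ).2
  have h1 := h (δ / 2) ⟨by positivity, by linarith⟩
  rw [hg.1] at h1
  have h2 := hx ((Quotient.out ζ).1 (δ / 2))
  by_contra! hpos
  have h3 : (0 : ℝ) < tangentSlope f ζ := by exact_mod_cast hpos
  have : 0 < (tangentSlope f ζ : ℝ) * (δ / 2) := by positivity
  linarith

lemma ordAt_nonpos {f : G → ℝ} (hf : IsRational f) {x : G} (hx : x ∈ maxLocus f) :
    ordAt f x ≤ 0 := by
  have := finsum_nonneg (f := fun ζ : TangentDir x => -tangentSlope f ζ)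
    fun ζ => neg_nonneg.2 (tangentSlope_nonpos hf hx ζ)
  rw [finsum_neg_distrib] at this
  exact neg_nonneg.1 this

/-- A tangent direction at a maximum of `f` leaves the maximum locus exactly when the slope
of `f` along it does not vanish. -/
lemma IsMetricGraph.leaves_maxLocus_iff (hG : IsMetricGraph G) {f : G → ℝ} (hf : IsRational f)
    {x : G} (hx : x ∈ maxLocus f) (ζ : TangentDir x) :
    (∃ δ > (0 : ℝ), ∀ t ∈ Ioo (0 : ℝ) δ, (Quotient.out ζ).1 t ∉ interior (maxLocus f)) ↔
      tangentSlope f ζ ≠ 0 := by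
  obtain ⟨δ, hδ, h⟩ := hasSlopeAlong_tangentSlope hf ζ
  obtain ⟨ε, hε, hg⟩ := (Quotient.out ζ).2
  constructor
  · rintro ⟨δ', hδ', hout⟩ h0
    rw [h0] at h
    set r := min (min δ δ') ε
    have hr : 0 < r := lt_min (lt_min hδ hδ') hε
    have hrδ : r ≤ δ := (min_le_left _ _).trans (min_le_left _ _)
    have hrδ' : r ≤ δ' := (min_le_left _ _).trans (min_le_right _ _)
    have hrε : r ≤ ε := min_le_right _ _
    have hsub : Ico (0 : ℝ) r ⊆ Ico 0 ε := Ico_subset_Ico_right hrε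
    obtain ⟨t, ht, hmem⟩ := hG.exists_mem_interior (Z := maxLocus f) hr
      ⟨hg.1, fun s hs t ht => hg.2 s (hsub hs) t (hsub ht)⟩ (fun t ht z => by
        have h1 := h t ⟨ht.1, ht.2.trans_le hrδ⟩
        rw [hg.1, Int.cast_zero, zero_mul, add_zero] at h1
        rw [h1]
        exact hx z)
    exact hout t ⟨ht.1, ht.2.trans_le hrδ'⟩ hmem
  · intro h0
    refine ⟨δ, hδ, fun t ht hmem => ?_⟩
    have h1 := h t ⟨ht.1.le, ht.2⟩
    rw [hg.1] at h1
    have h2 : f ((Quotient.out ζ).1 t) = f x := le_antisymm (hx _) (interior_subset hmem _)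
    have h3 : (tangentSlope f ζ : ℝ) * t = 0 := by linarith
    rcases mul_eq_zero.1 h3 with h4 | h4
    · exact h0 (by exact_mod_cast h4)
    · exact ht.1.ne' h4

lemma IsMetricGraph.degOut_maxLocus_le (hG : IsMetricGraph G) {f : G → ℝ} (hf : IsRational f)
    {x : G} (hx : x ∈ maxLocus f) : (degOut (maxLocus f) x : ℤ) ≤ -ordAt f x := by
  have hcard : degOut (maxLocus f) x =
      (support fun ζ : TangentDir x => tangentSlope f ζ).ncard := by
    simp only [degOut, hG.leaves_maxLocus_iff hf hx]
    rfl
  rw [hcard]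
  by_cases hfin : (support fun ζ : TangentDir x => tangentSlope f ζ).Finite
  · rw [ordAt, finsum_eq_sum _ hfin, ← Finset.sum_neg_distrib, ncard_eq_toFinset_card _ hfin]
    have := Finset.card_nsmul_le_sum hfin.toFinset (fun ζ => -tangentSlope f ζ) 1 (by
      intro ζ hζ
      have h1 : tangentSlope f ζ ≠ 0 := by simpa using hζ
      have h2 := tangentSlope_nonpos hf hx ζ
      omega)
    simpa using this
  · rw [Set.Infinite.ncard hfin]
    simpa using ordAt_nonpos hf hx

lemma IsMetricGraph.canFire_maxLocus (hG : IsMetricGraph G) {f : G → ℝ} {D : G → ℤ}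
    (hf : f ∈ RD D) (hne : (maxLocus f).Nonempty) : CanFire D (maxLocus f) := by
  have hcl := isClosed_maxLocus hf.1.1
  refine ⟨hne, hcl, hG.finite_compsOf_maxLocus hf.1, fun x hx => ?_⟩
  have h1 := hG.degOut_maxLocus_le hf.1 (hcl.frontier_subset hx)
  have h2 := hf.2 x
  linarith

lemma isRational_zero : IsRational (fun _ : G => (0 : ℝ)) :=
  ⟨continuous_const, fun _ _ _ _ _ => ⟨0, 1, one_pos, fun _ _ => by simp⟩⟩

lemma ordAt_zero (x : G) : ordAt (fun _ : G => (0 : ℝ)) x = 0 := by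
  refine finsum_eq_zero_of_forall_eq_zero fun ζ => ?_
  obtain ⟨δ, hδ, h⟩ := hasSlopeAlong_tangentSlope isRational_zero ζ
  have h1 := h (δ / 2) ⟨by positivity, by linarith⟩
  simpa [hδ.ne'] using h1

/-- a `v`-reduced divisor is linearly equivalent to an effective divisor if
and only if it is itself effective. -/
theorem reduced_linEquiv_effective_iff (hG : IsMetricGraph G) (v : G) (D : G → ℤ)
    (hD : FinSupp D) (hred : IsReduced v D) :
    (∃ D' : G → ℤ, FinSupp D' ∧ Effective D' ∧ LinEquiv D D') ↔ Effective D := by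
  constructor
  · rintro ⟨D', -, hD', f, hf, hDf⟩
    have := hG.1
    have hRD : f ∈ RD D := ⟨hf, fun x => hDf x ▸ hD' x⟩
    obtain ⟨y, -, hy⟩ := isCompact_univ.exists_isMaxOn ⟨v, mem_univ v⟩ hf.1.continuousOn
    have hne : (maxLocus f).Nonempty := ⟨y, fun z => hy (mem_univ z)⟩
    have hv : v ∈ maxLocus f := by
      by_contra hv
      exact hred.2 _ hv (hG.canFire_maxLocus hRD hne)
    intro x
    by_cases hx : x = v
    · subst hx
      linarith [hRD.2 x, ordAt_nonpos hf hv]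
    · exact hred.1 x hx
  · intro h
    exact ⟨D, hD, h, _, isRational_zero, fun x => by rw [ordAt_zero, add_zero]⟩

end TropGraph
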